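/- Let G be a finite group, V a finite-dimensional representation of G over a field k, K an arbitrary field extension of k, and V_K := K ⊗_k V the base-changed representation. Then β^r(G, V_K) ≤ β^r(G, V) and γ^r(G, V_K) ≤ γ^r(G, V). -/

import Mathlib

open MvPolynomial

noncomputable section

variable {k : Type} [Field k] {N : ℕ} {G : Type}

def mAct (M : Matrix (Fin N) (Fin N) k) :
    MvPolynomial (Fin N) k →ₐ[k] MvPolynomial (Fin N) k :=
  aeval fun i => ∑ j, C (M i j) * X j

lemma mAct_comp (A B : Matrix (Fin N) (Fin N) k) :
    (mAct A).comp (mAct B) = mAct (B * A) := by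
  apply MvPolynomial.algHom_ext
  intro i
  simp only [mAct, AlgHom.comp_apply, aeval_X, map_sum, map_mul, aeval_C, algebraMap_eq,
    Finset.mul_sum, Matrix.mul_apply, Finset.sum_mul]
  rw [Finset.sum_comm]
  simp [mul_assoc]

lemma mAct_one : mAct (1 : Matrix (Fin N) (Fin N) k) = AlgHom.id k _ := by
  apply MvPolynomial.algHom_ext
  intro i
  simp [mAct, Matrix.one_apply, ite_mul, apply_ite C]

def mEquiv (M : GL (Fin N) k) :
    MvPolynomial (Fin N) k ≃ₐ[k] MvPolynomial (Fin N) k :=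
  AlgEquiv.ofAlgHom (mAct (M : Matrix (Fin N) (Fin N) k))
    (mAct ((M⁻¹ : GL (Fin N) k) : Matrix (Fin N) (Fin N) k))
    (by rw [mAct_comp, Units.inv_mul, mAct_one])
    (by rw [mAct_comp, Units.mul_inv, mAct_one])

def fAct (M : GL (Fin N) k) :
    FractionRing (MvPolynomial (Fin N) k) ≃+* FractionRing (MvPolynomial (Fin N) k) :=
  IsFractionRing.ringEquivOfRingEquiv (mEquiv M).toRingEquiv

/-- `f` is an invariant rational function for the linear action `ρ`. -/
def IsInv (ρ : G → GL (Fin N) k) (f : FractionRing (MvPolynomial (Fin N) k)) : Prop :=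
  ∀ g, fAct (ρ g) f = f

/-- `f`, written as a quotient `f₁/f₂` of coprime polynomials, has
`deg f = deg f₁ + deg f₂ ≤ d`. -/
def RDegLE (f : FractionRing (MvPolynomial (Fin N) k)) (d : ℕ) : Prop :=
  ∃ f₁ f₂ : MvPolynomial (Fin N) k, f₂ ≠ 0 ∧
    (∀ p : MvPolynomial (Fin N) k, p ∣ f₁ → p ∣ f₂ → IsUnit p) ∧
    f = algebraMap (MvPolynomial (Fin N) k) (FractionRing (MvPolynomial (Fin N) k)) f₁ /
        algebraMap (MvPolynomial (Fin N) k) (FractionRing (MvPolynomial (Fin N) k)) f₂ ∧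
    f₁.totalDegree + f₂.totalDegree ≤ d

/-- `f` is (the image in `k(V)` of) a polynomial of degree at most `d`. -/
def PDegLE (f : FractionRing (MvPolynomial (Fin N) k)) (d : ℕ) : Prop :=
  ∃ p : MvPolynomial (Fin N) k, p.totalDegree ≤ d ∧
    f = algebraMap (MvPolynomial (Fin N) k) (FractionRing (MvPolynomial (Fin N) k)) p

/-- `β^r(G,V)`: the least `d` such that the invariant rational functions of degree at most `d`
generate the invariant field over `k`. -/
def betaR (ρ : G → GL (Fin N) k) : ℕ :=
  sInf {d : ℕ | ∀ f, IsInv ρ f →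
    f ∈ IntermediateField.adjoin k {h | IsInv ρ h ∧ RDegLE h d}}

/-- `β(G,V)`: the least `d` such that the invariant polynomials of degree at most `d`
generate the invariant field over `k`. -/
def betaP (ρ : G → GL (Fin N) k) : ℕ :=
  sInf {d : ℕ | ∀ f, IsInv ρ f →
    f ∈ IntermediateField.adjoin k {h | IsInv ρ h ∧ PDegLE h d}}

/-- `γ^r(G,V)`: the least `d` such that the invariant rational functions of degree at most `d`
contain a transcendence basis for the invariant field over `k`. -/
def gammaR (ρ : G → GL (Fin N) k) : ℕ :=
  sInf {d : ℕ | ∃ s : Set (FractionRing (MvPolynomial (Fin N) k)),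
    (∀ f ∈ s, IsInv ρ f ∧ RDegLE f d) ∧
    AlgebraicIndependent k ((↑) : s → FractionRing (MvPolynomial (Fin N) k)) ∧
    ∀ f, IsInv ρ f → IsAlgebraic (IntermediateField.adjoin k s) f}

/-- `γ(G,V)`: the least `d` such that the invariant polynomials of degree at most `d`
contain a transcendence basis for the invariant field over `k`. -/
def gammaP (ρ : G → GL (Fin N) k) : ℕ :=
  sInf {d : ℕ | ∃ s : Set (FractionRing (MvPolynomial (Fin N) k)),
    (∀ f ∈ s, IsInv ρ f ∧ PDegLE f d) ∧
    AlgebraicIndependent k ((↑) : s → FractionRing (MvPolynomial (Fin N) k)) ∧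
    ∀ f, IsInv ρ f → IsAlgebraic (IntermediateField.adjoin k s) f}

section helpers

lemma fAct_alg (M : GL (Fin N) k) (p : MvPolynomial (Fin N) k) :
    fAct M (algebraMap _ (FractionRing (MvPolynomial (Fin N) k)) p) =
      algebraMap _ _ (mAct (M : Matrix (Fin N) (Fin N) k) p) := by
  unfold fAct
  rw [IsFractionRing.ringEquivOfRingEquiv_algebraMap]
  rfl

lemma fAct_const (M : GL (Fin N) k) (c : k) :
    fAct M (algebraMap k (FractionRing (MvPolynomial (Fin N) k)) c) = algebraMap k _ c := by
  rw [IsScalarTower.algebraMap_apply k (MvPolynomial (Fin N) k), fAct_alg, AlgHom.commutes]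

lemma fAct_fAct (A B : GL (Fin N) k) (f : FractionRing (MvPolynomial (Fin N) k)) :
    fAct A (fAct B f) = fAct (B * A) f := by
  obtain ⟨p, q, hq, rfl⟩ := IsFractionRing.div_surjective (A := MvPolynomial (Fin N) k) f
  have h : ∀ p, mAct (A : Matrix (Fin N) (Fin N) k) (mAct (B : Matrix (Fin N) (Fin N) k) p)
      = mAct ((B * A : GL (Fin N) k) : Matrix (Fin N) (Fin N) k) p := by
    intro p
    rw [Units.val_mul, ← mAct_comp]; rfl
  simp only [map_div₀, fAct_alg, h]

lemma fAct_one (f : FractionRing (MvPolynomial (Fin N) k)) :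
    fAct (1 : GL (Fin N) k) f = f := by
  obtain ⟨p, q, hq, rfl⟩ := IsFractionRing.div_surjective (A := MvPolynomial (Fin N) k) f
  simp only [map_div₀, fAct_alg, Units.val_one, mAct_one, AlgHom.id_apply]

lemma rdeg_of (f₁ f₂ : MvPolynomial (Fin N) k) (h2 : f₂ ≠ 0) :
    RDegLE (algebraMap (MvPolynomial (Fin N) k) (FractionRing (MvPolynomial (Fin N) k)) f₁ /
        algebraMap (MvPolynomial (Fin N) k) (FractionRing (MvPolynomial (Fin N) k)) f₂)
        (f₁.totalDegree + f₂.totalDegree) := by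
  obtain ⟨a, b, c, hab, h1, h2'⟩ :=
    UniqueFactorizationMonoid.exists_reduced_factors' f₁ f₂ h2
  subst h1 h2'
  have hc : c ≠ 0 := left_ne_zero_of_mul h2
  have hb : b ≠ 0 := right_ne_zero_of_mul h2
  refine ⟨a, b, hb, fun p hp hq => hab hp hq, ?_, ?_⟩
  · rw [map_mul, map_mul, mul_div_mul_left]
    simpa using hc
  · have : ∀ a : MvPolynomial (Fin N) k, a.totalDegree ≤ (c * a).totalDegree := by
      intro a
      by_cases ha : a = 0
      · simp [ha]
      · rw [totalDegree_mul_of_isDomain hc ha]; omega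
    exact add_le_add (this a) (this b)

lemma RDegLE.mono' {f : FractionRing (MvPolynomial (Fin N) k)} {d e : ℕ} (h : RDegLE f d)
    (hde : d ≤ e) : RDegLE f e := by
  obtain ⟨a, b, h1, h2, h3, h4⟩ := h
  exact ⟨a, b, h1, h2, h3, h4.trans hde⟩

lemma exists_rdeg (f : FractionRing (MvPolynomial (Fin N) k)) : ∃ d, RDegLE f d := by
  obtain ⟨p, q, hq, rfl⟩ := IsFractionRing.div_surjective (A := MvPolynomial (Fin N) k) f
  exact ⟨_, rdeg_of p q (nonZeroDivisors.ne_zero hq)⟩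

lemma exists_rdeg_finset (s : Finset (FractionRing (MvPolynomial (Fin N) k))) :
    ∃ d, ∀ f ∈ s, RDegLE f d := by
  choose d hd using exists_rdeg (k := k) (N := N)
  exact ⟨s.sup d, fun f hf => (hd f).mono' (Finset.le_sup hf)⟩

/-- The invariant field. -/
def invF (ρ : G → GL (Fin N) k) :
    IntermediateField k (FractionRing (MvPolynomial (Fin N) k)) where
  carrier := {f | IsInv ρ f}
  mul_mem' := fun ha hb g => by rw [map_mul, ha g, hb g]
  add_mem' := fun ha hb g => by rw [map_add, ha g, hb g]
  algebraMap_mem' := fun c g => fAct_const _ c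
  inv_mem' := fun a ha g => by rw [map_inv₀, ha g]

lemma isInv_of_isAct [Group G] [Fintype G] (ρ : G →* GL (Fin N) k)
    (f : FractionRing (MvPolynomial (Fin N) k)) (i : ℕ) :
    IsInv (fun g => ρ g) ((∏ g : G, (Polynomial.X - Polynomial.C (fAct (ρ g) f))).coeff i) := by
  intro h
  have := Polynomial.coeff_map (p := ∏ g : G, (Polynomial.X - Polynomial.C (fAct (ρ g) f)))
    ((fAct (ρ h)).toRingHom) i
  change (fAct (ρ h)).toRingHom _ = _
  rw [← this, Polynomial.map_prod]
  congr 1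
  simp only [Polynomial.map_sub, Polynomial.map_X, Polynomial.map_C]
  refine Fintype.prod_equiv (Equiv.mulRight h) _ _ fun g => ?_
  simp only [Equiv.coe_mulRight, map_mul]
  rw [← fAct_fAct]
  rfl

lemma top_adjoin : IntermediateField.adjoin k (Set.range fun i : Fin N =>
    algebraMap (MvPolynomial (Fin N) k) (FractionRing (MvPolynomial (Fin N) k)) (X i)) = ⊤ := by
  rw [eq_top_iff]
  intro f _
  obtain ⟨p, q, hq, rfl⟩ := IsFractionRing.div_surjective (A := MvPolynomial (Fin N) k) f
  have : ∀ p, algebraMap (MvPolynomial (Fin N) k) (FractionRing (MvPolynomial (Fin N) k)) p ∈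
    IntermediateField.adjoin k (Set.range fun i : Fin N =>
    algebraMap (MvPolynomial (Fin N) k) (FractionRing (MvPolynomial (Fin N) k)) (X i)) := by
    intro p
    induction p using MvPolynomial.induction_on with
    | C a =>
      rw [← MvPolynomial.algebraMap_eq, ← IsScalarTower.algebraMap_apply]
      exact IntermediateField.algebraMap_mem _ _
    | add p q hp hq => rw [map_add]; exact add_mem hp hq
    | mul_X p i hp =>
      rw [map_mul]
      exact mul_mem hp (IntermediateField.subset_adjoin _ _ ⟨i, rfl⟩)
  exact div_mem (this p) (this q)

lemma exists_beta [Group G] [Finite G] (ρ : G →* GL (Fin N) k) :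
    ∃ d : ℕ, ∀ f, IsInv (fun g => ρ g) f →
    f ∈ IntermediateField.adjoin k {h | IsInv (fun g => ρ g) h ∧ RDegLE h d} := by
  classical
  have := Fintype.ofFinite G
  let x : Fin N → FractionRing (MvPolynomial (Fin N) k) := fun i =>
    algebraMap (MvPolynomial (Fin N) k) _ (X i)
  let P : Fin N → Polynomial (FractionRing (MvPolynomial (Fin N) k)) := fun i =>
    ∏ g : G, (Polynomial.X - Polynomial.C (fAct (ρ g) (x i)))
  obtain ⟨d, hd⟩ := exists_rdeg_finset (Finset.univ.biUnion fun i => (P i).coeffs)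
  let L := IntermediateField.adjoin k {h | IsInv (fun g => ρ g) h ∧ RDegLE h d}
  have hx : ∀ i, IsIntegral L (x i) := by
    intro i
    have hl : P i ∈ Polynomial.lifts (algebraMap L (FractionRing (MvPolynomial (Fin N) k))) := by
      rw [Polynomial.lifts_iff_coeff_lifts]
      intro n
      by_cases h0 : (P i).coeff n = 0
      · exact ⟨0, by rw [h0, map_zero]⟩
      refine ⟨⟨(P i).coeff n, ?_⟩, rfl⟩
      refine IntermediateField.subset_adjoin _ _ ⟨isInv_of_isAct ρ _ _, hd _ ?_⟩
      exact Finset.mem_biUnion.2 ⟨i, Finset.mem_univ _, Polynomial.coeff_mem_coeffs h0⟩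
    have hm : (P i).Monic := Polynomial.monic_prod_of_monic _ _ fun g _ => Polynomial.monic_X_sub_C _
    obtain ⟨q, hq, -, hqm⟩ := Polynomial.lifts_and_degree_eq_and_monic hl hm
    refine ⟨q, hqm, ?_⟩
    rw [← Polynomial.eval_map, hq, Polynomial.eval_prod]
    refine Finset.prod_eq_zero (Finset.mem_univ 1) ?_
    simp [fAct_one]
  have htop : IntermediateField.adjoin L (Set.range x) = ⊤ := by
    rw [eq_top_iff]
    intro f _
    have h1 : f ∈ IntermediateField.adjoin k (Set.range x) := by
      rw [top_adjoin]; trivial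
    have h2 : IntermediateField.adjoin k (Set.range x) ≤
        (IntermediateField.adjoin L (Set.range x)).restrictScalars k :=
      IntermediateField.adjoin_le_iff.2 (IntermediateField.subset_adjoin L _)
    exact h2 h1
  have hfd : FiniteDimensional L (FractionRing (MvPolynomial (Fin N) k)) := by
    have := IntermediateField.finiteDimensional_adjoin (K := L) (S := Set.range x)
      (by rintro _ ⟨i, rfl⟩; exact hx i)
    rw [htop] at this
    exact Module.Finite.equiv (IntermediateField.topEquiv (F := L)
      (E := FractionRing (MvPolynomial (Fin N) k))).toLinearEquiv
  have hL : L ≤ invF (fun g => ρ g) := IntermediateField.adjoin_le_iff.2 fun h hh => hh.1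
  let F : Submodule L (FractionRing (MvPolynomial (Fin N) k)) :=
    { carrier := {f | IsInv (fun g => ρ g) f}
      add_mem' := fun ha hb => (invF (fun g => ρ g)).add_mem ha hb
      zero_mem' := (invF (fun g => ρ g)).zero_mem
      smul_mem' := fun c a ha => (invF (fun g => ρ g)).mul_mem (hL c.2) ha }
  obtain ⟨B, hB⟩ : F.FG := IsNoetherian.noetherian F
  obtain ⟨e, he⟩ := exists_rdeg_finset B
  refine ⟨max d e, fun f hf => ?_⟩
  have hf' : f ∈ F := hf
  rw [← hB] at hf'
  have hle : L ≤ IntermediateField.adjoin k {h | IsInv (fun g => ρ g) h ∧ RDegLE h (max d e)} :=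
    IntermediateField.adjoin.mono _ _ _ fun h hh => ⟨hh.1, hh.2.mono' (le_max_left _ _)⟩
  clear hf
  induction hf' using Submodule.span_induction with
  | mem y hy =>
    refine IntermediateField.subset_adjoin _ _ ⟨?_, (he y hy).mono' (le_max_right _ _)⟩
    have : y ∈ F := hB ▸ Submodule.subset_span hy
    exact this
  | zero => exact zero_mem _
  | add a b ha hb iha ihb => exact add_mem iha ihb
  | smul c a ha iha => exact mul_mem (hle c.2) iha


section base
variable {K : Type} [Field K] [Algebra k K]

/-- base change of matrices -/
abbrev bc (K : Type) [Field K] [Algebra k K] (M : GL (Fin N) k) : GL (Fin N) K :=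
  Matrix.GeneralLinearGroup.map (algebraMap k K) M

lemma mAct_bc (M : GL (Fin N) k) (p : MvPolynomial (Fin N) k) :
    mAct (bc K M : Matrix (Fin N) (Fin N) K) (MvPolynomial.map (algebraMap k K) p) =
      MvPolynomial.map (algebraMap k K) (mAct (M : Matrix (Fin N) (Fin N) k) p) := by
  induction p using MvPolynomial.induction_on with
  | C a => simp [mAct]
  | add p q hp hq => simp only [map_add, hp, hq]
  | mul_X p i hp =>
    simp only [map_mul, hp]
    congr 1
    simp [mAct]

variable (k K N) in
/-- the embedding `k(V) → K(V)` -/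
def phi : FractionRing (MvPolynomial (Fin N) k) →+* FractionRing (MvPolynomial (Fin N) K) :=
  IsFractionRing.map (A := MvPolynomial (Fin N) k) (B := MvPolynomial (Fin N) K)
    (j := MvPolynomial.map (algebraMap k K))
    (MvPolynomial.map_injective _ (algebraMap k K).injective)

lemma phi_alg (p : MvPolynomial (Fin N) k) :
    phi k N K (algebraMap _ _ p) = algebraMap _ _ (MvPolynomial.map (algebraMap k K) p) := by
  unfold phi
  exact IsLocalization.map_eq _ _

lemma phi_const (c : k) :
    phi k N K (algebraMap k _ c) = algebraMap K _ (algebraMap k K c) := by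
  rw [IsScalarTower.algebraMap_apply k (MvPolynomial (Fin N) k),
    IsScalarTower.algebraMap_apply K (MvPolynomial (Fin N) K), phi_alg]
  simp [MvPolynomial.algebraMap_eq]

lemma phi_fAct (M : GL (Fin N) k) (f : FractionRing (MvPolynomial (Fin N) k)) :
    fAct (bc K M) (phi k N K f) = phi k N K (fAct M f) := by
  obtain ⟨p, q, hq, rfl⟩ := IsFractionRing.div_surjective (A := MvPolynomial (Fin N) k) f
  simp only [map_div₀, fAct_alg, phi_alg, mAct_bc]

lemma phi_rdeg {f : FractionRing (MvPolynomial (Fin N) k)} {d : ℕ} (h : RDegLE f d) :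
    RDegLE (phi k N K f) d := by
  obtain ⟨a, b, hb, -, rfl, hd⟩ := h
  rw [map_div₀, phi_alg, phi_alg]
  refine (rdeg_of _ _ ?_).mono' (le_trans ?_ hd)
  · exact (map_ne_zero_iff _ (MvPolynomial.map_injective _ (algebraMap k K).injective)).2 hb
  · have h : ∀ p : MvPolynomial (Fin N) k,
        (MvPolynomial.map (algebraMap k K) p).totalDegree ≤ p.totalDegree := by
      intro p
      rw [totalDegree, totalDegree]
      exact Finset.sup_mono (support_map_subset _ p)
    exact add_le_add (h a) (h b)

lemma phi_adjoin (S : Set (FractionRing (MvPolynomial (Fin N) k)))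
    {x : FractionRing (MvPolynomial (Fin N) k)} (hx : x ∈ IntermediateField.adjoin k S) :
    phi k N K x ∈ IntermediateField.adjoin K (phi k N K '' S) := by
  induction hx using IntermediateField.adjoin_induction with
  | mem x hx => exact IntermediateField.subset_adjoin _ _ ⟨x, hx, rfl⟩
  | algebraMap c => rw [phi_const]; exact IntermediateField.algebraMap_mem _ _
  | add x y _ _ hx hy => rw [map_add]; exact add_mem hx hy
  | inv x _ hx => rw [map_inv₀]; exact inv_mem hx
  | mul x y _ _ hx hy => rw [map_mul]; exact mul_mem hx hy

open TensorProduct in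
lemma poly_inv (ρ : G → GL (Fin N) k) (p : MvPolynomial (Fin N) K)
    (hp : ∀ g, mAct (bc K (ρ g) : Matrix (Fin N) (Fin N) K) p = p) :
    ∃ c : Module.Free.ChooseBasisIndex k K →₀ MvPolynomial (Fin N) k,
      (∀ i g, mAct (ρ g : Matrix (Fin N) (Fin N) k) (c i) = c i) ∧
      p = ∑ i ∈ c.support, C (Module.Free.chooseBasis k K i) *
        MvPolynomial.map (algebraMap k K) (c i) := by
  classical
  let e := MvPolynomial.algebraTensorAlgEquiv (σ := Fin N) k K
  let b := Module.Free.chooseBasis k K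
  let E := TensorProduct.equivFinsuppOfBasisLeft (N := MvPolynomial (Fin N) k) b
  have he : ∀ (M : GL (Fin N) k) t, mAct (bc K M : Matrix (Fin N) (Fin N) K) (e t) =
      e ((mAct (M : Matrix (Fin N) (Fin N) k)).toLinearMap.lTensor K t) := by
    intro M t
    induction t with
    | zero => simp
    | add x y hx hy => simp only [map_add, hx, hy]
    | tmul a q =>
      simp only [LinearMap.lTensor_tmul, e, MvPolynomial.algebraTensorAlgEquiv_tmul, map_smul,
        mAct_bc, AlgHom.toLinearMap_apply]
  have hE : ∀ (f : MvPolynomial (Fin N) k →ₗ[k] MvPolynomial (Fin N) k) t i,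
      E (f.lTensor K t) i = f (E t i) := by
    intro f t i
    induction t with
    | zero => simp
    | add x y hx hy => simp only [map_add, Finsupp.add_apply, hx, hy]
    | tmul a q =>
      simp only [LinearMap.lTensor_tmul, E, TensorProduct.equivFinsuppOfBasisLeft_apply_tmul_apply,
        map_smul]
  refine ⟨E (e.symm p), ?_, ?_⟩
  · intro i g
    have h1 := he (ρ g) (e.symm p)
    rw [AlgEquiv.apply_symm_apply, hp] at h1
    have h2 := congrArg e.symm h1
    rw [AlgEquiv.symm_apply_apply] at h2
    have h3 := hE (mAct (ρ g : Matrix (Fin N) (Fin N) k)).toLinearMap (e.symm p) i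
    rw [← h2] at h3
    exact h3.symm
  · have h1 : e (E.symm (E (e.symm p))) = p := by
      rw [LinearEquiv.symm_apply_apply, AlgEquiv.apply_symm_apply]
    conv_lhs => rw [← h1]
    rw [TensorProduct.equivFinsuppOfBasisLeft_symm_apply, Finsupp.sum, map_sum]
    refine Finset.sum_congr rfl fun i _ => ?_
    rw [MvPolynomial.algebraTensorAlgEquiv_tmul, MvPolynomial.smul_eq_C_mul]

lemma poly_inv_mem (ρ : G → GL (Fin N) k) (p : MvPolynomial (Fin N) K)
    (hp : IsInv (fun g => bc K (ρ g)) (algebraMap _ (FractionRing (MvPolynomial (Fin N) K)) p)) :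
    algebraMap _ (FractionRing (MvPolynomial (Fin N) K)) p ∈
      IntermediateField.adjoin K (phi k N K '' {f | IsInv ρ f}) := by
  obtain ⟨c, hc, h⟩ := poly_inv ρ p (fun g => by
    have := hp g
    rw [fAct_alg] at this
    exact IsFractionRing.injective _ _ this)
  rw [h, map_sum]
  refine sum_mem fun i _ => ?_
  rw [map_mul, ← MvPolynomial.algebraMap_eq, ← IsScalarTower.algebraMap_apply]
  refine mul_mem (IntermediateField.algebraMap_mem _ _) (IntermediateField.subset_adjoin _ _ ?_)
  refine ⟨algebraMap _ _ (c i), fun g => ?_, phi_alg _⟩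
  rw [fAct_alg, hc]

lemma inv_mem_adjoin [Group G] [Finite G] (ρ : G →* GL (Fin N) k)
    (f : FractionRing (MvPolynomial (Fin N) K)) (hf : IsInv (fun g => bc K (ρ g)) f) :
    f ∈ IntermediateField.adjoin K (phi k N K '' {f | IsInv (fun g => ρ g) f}) := by
  classical
  have := Fintype.ofFinite G
  obtain ⟨p, q, hq, hpq⟩ := IsFractionRing.div_surjective (A := MvPolynomial (Fin N) K) f
  have hq0 : q ≠ 0 := nonZeroDivisors.ne_zero hq
  let Q : MvPolynomial (Fin N) K :=
    ∏ g : G, mAct (bc K (ρ g) : Matrix (Fin N) (Fin N) K) q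
  have hQ0 : Q ≠ 0 := Finset.prod_ne_zero_iff.2 fun g _ =>
    (map_ne_zero_iff (mEquiv (bc K (ρ g))) (mEquiv (bc K (ρ g))).injective).2 hq0
  have hQ : IsInv (fun g => bc K (ρ g))
      (algebraMap _ (FractionRing (MvPolynomial (Fin N) K)) Q) := by
    intro h
    simp only [Q, map_prod, ← fAct_alg, fAct_fAct]
    refine Fintype.prod_equiv (Equiv.mulRight h) _ _ fun g => ?_
    simp only [Equiv.coe_mulRight, map_mul]
  obtain ⟨c, hc⟩ : q ∣ Q := by
    have := Finset.dvd_prod_of_mem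
      (fun g : G => mAct (bc K (ρ g) : Matrix (Fin N) (Fin N) K) q) (Finset.mem_univ (1 : G))
    have h1 : mAct (bc K (ρ 1) : Matrix (Fin N) (Fin N) K) q = q := by simp [mAct_one]
    change mAct (bc K (ρ 1) : Matrix (Fin N) (Fin N) K) q ∣ Q at this
    rwa [h1] at this
  have hfQ : f * algebraMap _ _ Q = algebraMap _ _ (p * c) := by
    have : algebraMap _ (FractionRing (MvPolynomial (Fin N) K)) q ≠ 0 := by simpa using hq0
    rw [← hpq, hc, map_mul, map_mul]
    field_simp
  have hQ1 : algebraMap _ (FractionRing (MvPolynomial (Fin N) K)) Q ≠ 0 := by simpa using hQ0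
  rw [← mul_div_cancel_right₀ f hQ1]
  refine div_mem ?_ (poly_inv_mem _ _ hQ)
  rw [hfQ]
  refine poly_inv_mem _ _ ?_
  rw [← hfQ]
  intro g
  rw [map_mul, hf g, hQ g]

end base

lemma gamma_iff (ρ : G → GL (Fin N) k) (d : ℕ) :
    (∃ s : Set (FractionRing (MvPolynomial (Fin N) k)),
      (∀ f ∈ s, IsInv ρ f ∧ RDegLE f d) ∧
      AlgebraicIndependent k ((↑) : s → FractionRing (MvPolynomial (Fin N) k)) ∧
      ∀ f, IsInv ρ f → IsAlgebraic (IntermediateField.adjoin k s) f) ↔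
    ∀ f, IsInv ρ f → IsAlgebraic (IntermediateField.adjoin k {h | IsInv ρ h ∧ RDegLE h d}) f := by
  constructor
  · rintro ⟨s, hs, -, h⟩ f hf
    have hle : IntermediateField.adjoin k s ≤
      IntermediateField.adjoin k {h | IsInv ρ h ∧ RDegLE h d} :=
      IntermediateField.adjoin.mono _ _ _ hs
    exact (h f hf).ringHom_of_comp_eq (IntermediateField.inclusion hle)
      (RingHom.id (FractionRing (MvPolynomial (Fin N) k)))
      (IntermediateField.inclusion hle).injective rfl
  · intro h
    obtain ⟨t, ht⟩ := (AlgebraicIndependent.matroid k (FractionRing (MvPolynomial (Fin N) k))).exists_isBasis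
      {h | IsInv ρ h ∧ RDegLE h d} (by simp)
    have ht' := AlgebraicIndependent.matroid_isBasis_iff.1 ht
    refine ⟨t, ht'.2.1, ht'.1, fun f hf => ?_⟩
    have := h f hf
    rw [IntermediateField.isAlgebraic_adjoin_iff] at this ⊢
    exact (AlgebraicIndependent.isAlgebraic_adjoin_iff_of_matroid_isBasis ht).2 this

end helpers

/-- Base change can only lower `β^r` and `γ^r`: for a field extension `K/k`,
`β^r(G, V_K) ≤ β^r(G, V)` and `γ^r(G, V_K) ≤ γ^r(G, V)`. -/
theorem stmt2 {k K : Type} [Field k] [Field K] [Algebra k K] {N : ℕ} {G : Type}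
    [Group G] [Finite G] (ρ : G →* GL (Fin N) k) :
    betaR (fun g => (Matrix.GeneralLinearGroup.map (algebraMap k K)).comp ρ g) ≤
      betaR (fun g => ρ g) ∧
    gammaR (fun g => (Matrix.GeneralLinearGroup.map (algebraMap k K)).comp ρ g) ≤
      gammaR (fun g => ρ g) := by
  have hinv : ∀ f, IsInv (fun g => ρ g) f → IsInv (fun g => bc K (ρ g)) (phi k N K f) := by
    intro f hf g
    rw [phi_fAct, hf g]
  have himg : ∀ d, phi k N K '' {h | IsInv (fun g => ρ g) h ∧ RDegLE h d} ⊆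
      {h | IsInv (fun g => bc K (ρ g)) h ∧ RDegLE h d} := by
    rintro d _ ⟨h, hh, rfl⟩
    exact ⟨hinv h hh.1, phi_rdeg hh.2⟩
  obtain ⟨d₀, hd₀⟩ := exists_beta ρ
  constructor
  · apply Nat.sInf_le
    have hd := Nat.sInf_mem (s := {d : ℕ | ∀ f, IsInv (fun g => ρ g) f →
      f ∈ IntermediateField.adjoin k {h | IsInv (fun g => ρ g) h ∧ RDegLE h d}}) ⟨d₀, hd₀⟩
    change betaR (fun g => ρ g) ∈ _ at hd
    generalize betaR (fun g => ρ g) = d at hd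
    intro f hf
    refine IntermediateField.adjoin_le_iff.2 ?_ (inv_mem_adjoin ρ f hf)
    rintro _ ⟨x, hx, rfl⟩
    exact IntermediateField.adjoin.mono _ _ _ (himg d) (phi_adjoin _ (hd x hx))
  · apply Nat.sInf_le
    have hd : gammaR (fun g => ρ g) ∈ _ := Nat.sInf_mem ⟨d₀, (gamma_iff _ _).2 fun f hf =>
      isAlgebraic_algebraMap (⟨f, hd₀ f hf⟩ : IntermediateField.adjoin k _)⟩
    generalize gammaR (fun g => ρ g) = d at hd
    replace hd := (gamma_iff _ _).1 hd
    refine (gamma_iff _ _).2 fun f hf => ?_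
    let L := IntermediateField.adjoin K {h | IsInv (fun g => bc K (ρ g)) h ∧ RDegLE h d}
    let E : IntermediateField K (FractionRing (MvPolynomial (Fin N) K)) :=
      (algebraicClosure L (FractionRing (MvPolynomial (Fin N) K))).restrictScalars K
    suffices hE : f ∈ E from mem_algebraicClosure_iff.1 hE
    refine IntermediateField.adjoin_le_iff.2 ?_ (inv_mem_adjoin ρ f hf)
    rintro _ ⟨x, hx, rfl⟩
    refine mem_algebraicClosure_iff.2 ?_
    let ψ : IntermediateField.adjoin k {h | IsInv (fun g => ρ g) h ∧ RDegLE h d} →+* L :=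
      ((phi k N K).comp (algebraMap _ _)).codRestrict L fun y =>
        IntermediateField.adjoin.mono _ _ _ (himg d) (phi_adjoin _ y.2)
    exact (hd x hx).ringHom_of_comp_eq ψ (phi k N K) ψ.injective rfl
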